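/- arXiv:1202.2006 — 2 statements merged into one kernel-verified Lean document; each statement's English description precedes it below -/
import Mathlib

section
/- For every integer k ≥ 1 and every real number t ≠ 0, 1/(e^t - 1)^k = (-1)^k · a_{k,0} + ∑_{i=1}^{k} (-1)^{k+i} · a_{k,i-1} · g^{(i-1)}(t), where g^{(i-1)}(t) denotes the (i-1)-th derivative at t of the function g(t) = 1/(1 - e^{-t}), and where the rational coefficients a_{k,i-1} are given by the determinant formula a_{k,i-1} = (-1)^{i+1} · det M(k,i). -/
/-- The Stirling numbers of the second kind, via the explicit formula. -/
def S (n m : ℕ) : ℚ :=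
  (1 / (m.factorial : ℚ)) *
    ∑ ℓ ∈ Finset.range (m + 1), (-1 : ℚ) ^ (m - ℓ) * (m.choose ℓ : ℚ) * (ℓ : ℚ) ^ n

/-- The `(k-i+1) × (k-i+1)` matrix `M(k,i)`: for `r c : Fin (k-i+1)` (zero-indexed, so the
row is `r+1` and the column `c+1` in the one-indexed description), the first-column entry
is `(1/(i+r-1)!) ⬝ C(k, i+r)` and the entry in a later column `c` is `S(i+c, i+r)`. -/
def M (k i : ℕ) : Matrix (Fin (k - i + 1)) (Fin (k - i + 1)) ℚ := fun r c =>
  if c.val = 0 then (1 / ((i + r.val - 1).factorial : ℚ)) * (k.choose (i + r.val) : ℚ)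
  else S (i + c.val) (i + r.val)

/-- The coefficient `a_{k,i-1} = (-1)^{i+1} det M(k,i)`; here `a k i` stands for
the quantity denoted `a_{k,i-1}` (so `i` runs from `1` to `k`). -/
def a (k i : ℕ) : ℚ := (-1 : ℚ) ^ (i + 1) * (M k i).det

theorem S_zero_right (n : ℕ) : S (n + 1) 0 = 0 := by
  simp [S]

theorem S_zero_left (m : ℕ) : S 0 (m + 1) = 0 := by
  have h := Int.alternating_sum_range_choose_of_ne (n := m + 1) (by omega)
  have h' : ∑ l ∈ Finset.range (m + 1 + 1), (-1 : ℚ) ^ l * ((m + 1).choose l : ℚ) = 0 := by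
    exact_mod_cast h
  unfold S
  rw [mul_eq_zero]
  right
  have : ∀ l ∈ Finset.range (m + 1 + 1),
      (-1 : ℚ) ^ (m + 1 - l) * ((m + 1).choose l : ℚ) * (l : ℚ) ^ 0
        = (-1) ^ (m + 1) * ((-1 : ℚ) ^ l * ((m + 1).choose l : ℚ)) := by
    intro l hl
    have hl' : l ≤ m + 1 := by simpa [Nat.lt_succ_iff] using hl
    obtain ⟨d, hd⟩ := Nat.exists_eq_add_of_le hl'
    rw [hd, show l + d - l = d by omega, pow_add]
    have : (-1 : ℚ) ^ l * (-1 : ℚ) ^ l = 1 := by rw [← mul_pow]; simp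
    linear_combination (-((-1 : ℚ) ^ d * ((l + d).choose l : ℚ))) * this
  rw [Finset.sum_congr rfl this, ← Finset.mul_sum, h', mul_zero]

theorem S_succ_succ (n m : ℕ) :
    S (n + 1) (m + 1) = (m + 1) * S n (m + 1) + S n m := by
  have key : ∑ l ∈ Finset.range (m + 1 + 1),
        (-1 : ℚ) ^ (m + 1 - l) * ((m + 1).choose l : ℚ) * (l : ℚ) ^ (n + 1)
      = (m + 1) * (∑ l ∈ Finset.range (m + 1 + 1),
          (-1 : ℚ) ^ (m + 1 - l) * ((m + 1).choose l : ℚ) * (l : ℚ) ^ n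
        + ∑ l ∈ Finset.range (m + 1),
          (-1 : ℚ) ^ (m - l) * (m.choose l : ℚ) * (l : ℚ) ^ n) := by
    rw [Finset.sum_range_succ, Finset.sum_range_succ _ (m + 1), add_right_comm,
      ← Finset.sum_add_distrib, mul_add, Finset.mul_sum]
    congr 1
    · apply Finset.sum_congr rfl
      intro l hl
      have hl' : l ≤ m := by simpa [Nat.lt_succ_iff] using hl
      have hc : (l : ℚ) * ((m + 1).choose l : ℚ)
          = (m + 1) * (((m + 1).choose l : ℚ) - (m.choose l : ℚ)) := by
        cases l with
        | zero => simp
        | succ l =>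
          have h1 := Nat.add_one_mul_choose_eq m l
          have h2 := Nat.choose_succ_succ m l
          have h1' : ((m : ℚ) + 1) * (m.choose l : ℚ) = ((m + 1).choose (l + 1) : ℚ) * (l + 1) := by
            exact_mod_cast h1
          have h2' : ((m + 1).choose (l + 1) : ℚ) = m.choose l + m.choose (l + 1) := by
            exact_mod_cast h2
          push_cast
          linear_combination (-h1') - (m + 1) * h2'
      rw [show m + 1 - l = (m - l) + 1 by omega, pow_succ, pow_succ]
      linear_combination (-(-1 : ℚ) ^ (m - l) * (l : ℚ) ^ n) * hc
    · simp; ring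
  unfold S
  rw [key, Nat.factorial_succ]
  have : (m.factorial : ℚ) ≠ 0 := by positivity
  have : (m + 1 : ℚ) ≠ 0 := by positivity
  push_cast
  field_simp

theorem S_of_lt (n : ℕ) : ∀ m, n < m → S n m = 0 := by
  induction n with
  | zero =>
    intro m hm
    obtain ⟨m, rfl⟩ : ∃ m', m = m' + 1 := ⟨m - 1, by omega⟩
    exact S_zero_left m
  | succ n ih =>
    intro m hm
    obtain ⟨m, rfl⟩ : ∃ m', m = m' + 1 := ⟨m - 1, by omega⟩
    rw [S_succ_succ, ih _ (by omega), ih _ (by omega)]; simp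

theorem S_self (n : ℕ) : S n n = 1 := by
  induction n with
  | zero => simp [S]
  | succ n ih => rw [S_succ_succ, ih, S_of_lt n _ (by omega)]; simp

theorem S_alt_sum (n K : ℕ) (h : n < K) :
    ∑ m ∈ Finset.range K, (-1 : ℚ) ^ m * (m.factorial : ℚ) * S (n + 1) (m + 1)
      = if n = 0 then 1 else 0 := by
  have : ∀ m ∈ Finset.range K, (-1 : ℚ) ^ m * (m.factorial : ℚ) * S (n + 1) (m + 1)
      = (fun m => (-1 : ℚ) ^ m * (m.factorial : ℚ) * S n m) m
        - (fun m => (-1 : ℚ) ^ m * (m.factorial : ℚ) * S n m) (m + 1) := by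
    intro m _
    simp only [S_succ_succ, Nat.factorial_succ, pow_succ]
    push_cast; ring
  rw [Finset.sum_congr rfl this, Finset.sum_range_sub']
  simp only [S_of_lt n K h]
  cases n with
  | zero => simp [S_self]
  | succ n => simp [S_zero_right]

theorem g_deriv (t : ℝ) (ht : t ≠ 0) :
    HasDerivAt (fun s : ℝ => 1 / (1 - Real.exp (-s)))
      (1 / (1 - Real.exp (-t)) - (1 / (1 - Real.exp (-t))) ^ 2) t := by
  have h0 : 1 - Real.exp (-t) ≠ 0 := by
    intro h
    have : Real.exp (-t) = 1 := by linarith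
    rw [Real.exp_eq_one_iff] at this
    exact ht (by linarith)
  have h1 : HasDerivAt (fun s : ℝ => 1 - Real.exp (-s)) (Real.exp (-t)) t := by
    simpa using ((hasDerivAt_neg t).exp).const_sub 1
  have h2 := h1.inv h0
  simp only [one_div]
  refine h2.congr_deriv ?_
  field_simp
  ring

theorem g_iter (K n : ℕ) (hn : n < K) : ∀ t : ℝ, t ≠ 0 →
    iteratedDeriv n (fun s : ℝ => 1 / (1 - Real.exp (-s))) t
      = ∑ m ∈ Finset.range K, (-1 : ℝ) ^ m * (m.factorial : ℝ) * (S (n + 1) (m + 1) : ℝ)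
          * (1 / (1 - Real.exp (-t))) ^ (m + 1) := by
  induction n with
  | zero =>
    intro t ht
    rw [iteratedDeriv_zero, Finset.sum_eq_single 0]
    · simp [S_self]
    · intro m _ hm
      rw [S_of_lt _ _ (by omega)]; simp
    · intro h; simp at h; omega
  | succ n ih =>
    intro t ht
    rw [iteratedDeriv_succ]
    have he : iteratedDeriv n (fun s : ℝ => 1 / (1 - Real.exp (-s))) =ᶠ[nhds t]
        fun t => ∑ m ∈ Finset.range K, (-1 : ℝ) ^ m * (m.factorial : ℝ)
          * (S (n + 1) (m + 1) : ℝ) * (1 / (1 - Real.exp (-t))) ^ (m + 1) := by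
      filter_upwards [isOpen_ne.mem_nhds ht] with s hs
      exact ih (by omega) s hs
    rw [he.deriv_eq]
    have hd := HasDerivAt.fun_sum (u := Finset.range K) (fun m _ =>
      ((g_deriv t ht).fun_pow (m + 1)).const_mul
        ((-1 : ℝ) ^ m * (m.factorial : ℝ) * (S (n + 1) (m + 1) : ℝ)))
    rw [hd.deriv]
    set x := 1 / (1 - Real.exp (-t)) with hx
    rw [← sub_eq_zero, ← Finset.sum_sub_distrib]
    have : ∀ m ∈ Finset.range K,
        ((-1 : ℝ) ^ m * (m.factorial : ℝ) * (S (n + 1) (m + 1) : ℝ)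
            * (((m + 1 : ℕ) : ℝ) * x ^ (m + 1 - 1) * (x - x ^ 2))
          - (-1 : ℝ) ^ m * (m.factorial : ℝ) * (S (n + 1 + 1) (m + 1) : ℝ) * x ^ (m + 1))
        = (fun m => (-1 : ℝ) ^ m * (m.factorial : ℝ) * (S (n + 1) m : ℝ) * x ^ (m + 1)) (m + 1)
        - (fun m => (-1 : ℝ) ^ m * (m.factorial : ℝ) * (S (n + 1) m : ℝ) * x ^ (m + 1)) m := by
      intro m _
      rw [S_succ_succ (n + 1)]
      simp only [Nat.factorial_succ, pow_succ, Nat.add_sub_cancel]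
      push_cast; ring
    rw [Finset.sum_congr rfl this, Finset.sum_range_sub
      (fun m => (-1 : ℝ) ^ m * (m.factorial : ℝ) * (S (n + 1) m : ℝ) * x ^ (m + 1))]
    simp [S_of_lt (n + 1) K hn, S_zero_right]

/-- The unitriangular matrix of Stirling numbers. -/
def Amat (k i : ℕ) : Matrix (Fin (k - i + 1)) (Fin (k - i + 1)) ℚ := fun r c =>
  S (i + c.val) (i + r.val)

theorem Amat_det (k i : ℕ) : (Amat k i).det = 1 := by
  rw [Matrix.det_of_isUpperTriangular]
  · simp [Amat, S_self]
  · intro r c h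
    have h' : c.val < r.val := h
    exact S_of_lt _ _ (by omega)

theorem exists_Y (k : ℕ) (hk : 1 ≤ k) (v : ℕ → ℚ) : ∃ Y : ℕ → ℚ, ∀ m ∈ Finset.Icc 1 k,
    ∑ n ∈ Finset.Icc 1 k, S n m * Y n = v m := by
  let w : Fin (k - 1 + 1) → ℚ := fun r => v (1 + r.val)
  let y := (Amat k 1).cramer w
  have hy : (Amat k 1).mulVec y = w := by
    rw [Matrix.mulVec_cramer, Amat_det, one_smul]
  refine ⟨fun n => if h : n - 1 < k - 1 + 1 then y ⟨n - 1, h⟩ else 0, ?_⟩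
  intro m hm
  rw [Finset.mem_Icc] at hm
  have h := congrFun hy ⟨m - 1, by omega⟩
  simp only [w, Matrix.mulVec, dotProduct, Amat] at h
  rw [show 1 + (m - 1) = m by omega] at h
  rw [← h, ← Finset.Ico_add_one_right_eq_Icc, Finset.sum_Ico_eq_sum_range,
    show k + 1 - 1 = k - 1 + 1 by omega, ← Fin.sum_univ_eq_sum_range
      (fun j => S (1 + j) m * (if h : 1 + j - 1 < k - 1 + 1 then y ⟨1 + j - 1, h⟩ else 0))]
  apply Finset.sum_congr rfl
  intro j _
  simp only [Nat.add_sub_cancel_left, j.isLt, dif_pos]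

theorem det_solves (k : ℕ) (hk : 1 ≤ k) (m : ℕ) (hm : m ∈ Finset.Icc 1 k) :
    ∑ n ∈ Finset.Icc 1 k, S n m * (M k n).det
      = (1 / ((m - 1).factorial : ℚ)) * (k.choose m : ℚ) := by
  obtain ⟨Y, hY⟩ := exists_Y k hk
    (fun m => (1 / ((m - 1).factorial : ℚ)) * (k.choose m : ℚ))
  rw [← hY m hm]
  apply Finset.sum_congr rfl
  intro i hi
  congr 1
  rw [Finset.mem_Icc] at hi
  let y : Fin (k - i + 1) → ℚ := fun c => Y (i + c.val)
  let w : Fin (k - i + 1) → ℚ := fun r =>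
    (1 / ((i + r.val - 1).factorial : ℚ)) * (k.choose (i + r.val) : ℚ)
  have hw : (Amat k i).mulVec y = w := by
    funext r
    have hr := r.isLt
    have h := hY (i + r.val) (by rw [Finset.mem_Icc]; omega)
    simp only [w, Matrix.mulVec, dotProduct, Amat, y]
    clear_value y w
    rw [← h]
    clear h
    generalize r.val = q at *
    rw [Fin.sum_univ_eq_sum_range (fun c => S (i + c) (i + q) * Y (i + c)),
      show k - i + 1 = k + 1 - i by omega,
      ← Finset.sum_Ico_eq_sum_range (fun c => S c (i + q) * Y c),
      Finset.Ico_add_one_right_eq_Icc]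
    apply Finset.sum_subset
    · exact Finset.Icc_subset_Icc_left hi.1
    · intro x hx hx'
      rw [Finset.mem_Icc] at hx hx'
      rw [S_of_lt _ _ (by omega), zero_mul]
  have hc : (Amat k i).cramer w = y := by
    rw [← hw, Matrix.cramer_eq_adjugate_mulVec, Matrix.mulVec_mulVec, Matrix.adjugate_mul,
      Amat_det, one_smul, Matrix.one_mulVec]
  have h0 := congrFun hc 0
  rw [Matrix.cramer_apply] at h0
  have hM : M k i = (Amat k i).updateCol 0 w := by
    ext r c
    rw [Matrix.updateCol_apply]
    simp only [M, Amat, w, Fin.ext_iff, Fin.val_zero]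
  rw [hM, h0]
  simp [y]

theorem det_solves' (k : ℕ) (hk : 1 ≤ k) (m : ℕ) (hm : m < k) :
    ∑ n ∈ Finset.Icc 1 k, (m.factorial : ℚ) * S n (m + 1) * (M k n).det
      = (k.choose (m + 1) : ℚ) := by
  have h := det_solves k hk (m + 1) (by rw [Finset.mem_Icc]; omega)
  have hf : (m.factorial : ℚ) ≠ 0 := by positivity
  simp only [mul_assoc]
  rw [← Finset.mul_sum, h]
  simp only [Nat.add_sub_cancel]
  field_simp

theorem det_one (k : ℕ) (hk : 1 ≤ k) : (M k 1).det = 1 := by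
  have h1 : ∑ m ∈ Finset.range k, (-1 : ℚ) ^ m * (k.choose (m + 1) : ℚ) = 1 := by
    have h := Int.alternating_sum_range_choose_of_ne (n := k) (by omega)
    have h' : ∑ l ∈ Finset.range (k + 1), (-1 : ℚ) ^ l * (k.choose l : ℚ) = 0 := by
      exact_mod_cast h
    rw [Finset.sum_range_succ'] at h'
    simp only [pow_succ, mul_neg, mul_one, neg_mul, Finset.sum_neg_distrib] at h'
    simp at h'
    linarith
  rw [← h1, Finset.sum_congr rfl (fun m hm => by
    rw [← det_solves' k hk m (Finset.mem_range.1 hm), Finset.mul_sum]), Finset.sum_comm]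
  rw [Finset.sum_eq_single 1]
  · have := S_alt_sum 0 k (by omega)
    simp only [if_true] at this
    simp only [← mul_assoc]
    rw [← Finset.sum_mul, this, one_mul]
  · intro n hn hn1
    rw [Finset.mem_Icc] at hn
    obtain ⟨n, rfl⟩ : ∃ n', n = n' + 1 := ⟨n - 1, by omega⟩
    have := S_alt_sum n k (by omega)
    rw [if_neg (by omega)] at this
    simp only [← mul_assoc]
    rw [← Finset.sum_mul, this, zero_mul]
  · intro h; rw [Finset.mem_Icc] at h; omega

theorem one_div_exp_sub_one_pow_eq' (k : ℕ) (hk : 1 ≤ k) (t : ℝ) (ht : t ≠ 0) :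
    1 / (Real.exp t - 1) ^ k =
      (-1 : ℝ) ^ k * (a k 1 : ℝ) +
        ∑ i ∈ Finset.Icc 1 k,
          ((-1 : ℝ) ^ (k + i) * (a k i : ℝ)) *
            iteratedDeriv (i - 1) (fun s : ℝ => 1 / (1 - Real.exp (-s))) t := by
  set x := 1 / (1 - Real.exp (-t)) with hx
  have hL : 1 / (Real.exp t - 1) ^ k = (x - 1) ^ k := by
    rw [← one_div_pow]
    congr 1
    have h0 : Real.exp t - 1 ≠ 0 := by
      intro h
      exact ht (Real.exp_eq_one_iff t |>.1 (by linarith))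
    have h1 : Real.exp t ≠ 0 := (Real.exp_pos t).ne'
    have h2 : x = Real.exp t / (Real.exp t - 1) := by
      rw [hx, Real.exp_neg]
      field_simp
    rw [h2]
    field_simp
    ring
  have hsq : ∀ n : ℕ, (-1 : ℝ) ^ n * (-1 : ℝ) ^ n = 1 := by
    intro n; rw [← mul_pow]; simp
  have hR : ∀ i ∈ Finset.Icc 1 k, ((-1 : ℝ) ^ (k + i) * (a k i : ℝ)) *
            iteratedDeriv (i - 1) (fun s : ℝ => 1 / (1 - Real.exp (-s))) t
      = ∑ m ∈ Finset.range k, -(-1 : ℝ) ^ k * ((-1 : ℝ) ^ m * x ^ (m + 1))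
          * ((m.factorial : ℝ) * (S i (m + 1) : ℝ) * ((M k i).det : ℝ)) := by
    intro i hi
    rw [Finset.mem_Icc] at hi
    rw [g_iter k (i - 1) (by omega) t ht, ← hx, show i - 1 + 1 = i by omega, Finset.mul_sum]
    apply Finset.sum_congr rfl
    intro m _
    simp only [a, pow_add]
    generalize (M k i).det = D
    push_cast
    linear_combination (-(-1 : ℝ) ^ k * ((-1 : ℝ) ^ m * x ^ (m + 1))
          * ((m.factorial : ℝ) * (S i (m + 1) : ℝ) * (D : ℝ))) * hsq i
  rw [hL, Finset.sum_congr rfl hR, Finset.sum_comm]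
  have hdet : ∀ m ∈ Finset.range k, ∑ i ∈ Finset.Icc 1 k,
      -(-1 : ℝ) ^ k * ((-1 : ℝ) ^ m * x ^ (m + 1))
          * ((m.factorial : ℝ) * (S i (m + 1) : ℝ) * ((M k i).det : ℝ))
      = (-1 : ℝ) ^ k * ((-x) ^ (m + 1) * (k.choose (m + 1) : ℝ)) := by
    intro m hm
    have h := det_solves' k hk m (Finset.mem_range.1 hm)
    have h' : ∑ n ∈ Finset.Icc 1 k, (m.factorial : ℝ) * (S n (m + 1) : ℝ) * ((M k n).det : ℝ)
      = (k.choose (m + 1) : ℝ) := by exact_mod_cast h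
    rw [← Finset.mul_sum, h', neg_pow x]
    ring
  rw [Finset.sum_congr rfl hdet, ← Finset.mul_sum]
  have hb : (x - 1) ^ k = (-1 : ℝ) ^ k * (-x + 1) ^ k := by
    rw [← mul_pow]; congr 1; ring
  rw [hb, add_pow, Finset.sum_range_succ']
  simp [a, det_one k hk]
  ring
end

section
/- For every integer k ≥ 1, the coefficient a_{k,0} equals 1; that is, the determinant of the k×k rational matrix M(k,1), whose entry in row r and column 1 is (1/(r-1)!) · C(k, r) and whose entry in row r and column c for 2 ≤ c ≤ k is S(c, r), equals 1. -/
lemma S_rec (n m : ℕ) : S (n+1) (m+1) = (m+1) * S n (m+1) + S n m := by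
  have key : ∑ l ∈ Finset.range (m+1+1), (-1 : ℚ) ^ (m+1 - l) * ((m+1).choose l : ℚ) * (l : ℚ) ^ (n+1)
      = (m+1) * (∑ l ∈ Finset.range (m+1+1), (-1 : ℚ) ^ (m+1 - l) * ((m+1).choose l : ℚ) * (l : ℚ) ^ n)
       + (m+1) * ∑ l ∈ Finset.range (m+1), (-1 : ℚ) ^ (m - l) * (m.choose l : ℚ) * (l : ℚ) ^ n := by
    rw [Finset.sum_range_succ, Finset.sum_range_succ _ (m+1), mul_add, Finset.mul_sum, Finset.mul_sum,
      add_right_comm, ← Finset.sum_add_distrib]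
    congr 1
    · apply Finset.sum_congr rfl
      intro l hl
      have hl' : l ≤ m := by simpa [Nat.lt_succ_iff] using hl
      have h1 : m + 1 - l = (m - l) + 1 := by omega
      have h2 : ((m+1).choose l : ℚ) * ((m:ℚ) + 1 - l) = (m.choose l : ℚ) * (m + 1) := by
        have h := Nat.choose_mul_succ_eq m l
        have h3 : (((m.choose l) * (m+1) : ℕ) : ℚ) = (((m+1).choose l * (m + 1 - l) : ℕ) : ℚ) := by
          rw [h]
        rw [Nat.cast_mul, Nat.cast_mul, Nat.cast_sub (by omega)] at h3
        push_cast at h3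
        exact h3.symm
      rw [h1, pow_succ, pow_succ]
      linear_combination ((-1 : ℚ) ^ (m - l) * (l:ℚ)^n) * h2
    · push_cast
      ring
  unfold S
  rw [key, Nat.factorial_succ]
  have : (m.factorial : ℚ) ≠ 0 := by positivity
  have : (m : ℚ) + 1 ≠ 0 := by positivity
  push_cast
  field_simp

lemma S_zero_succ (m : ℕ) : S 0 (m+1) = 0 := by
  have h := add_pow (1 : ℚ) (-1) (m+1)
  unfold S
  rw [mul_eq_zero]
  right
  simp only [one_pow, one_mul] at h
  simp only [pow_zero, mul_one]
  rw [← h]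
  simp

lemma S_eq (n m : ℕ) : S n m = Nat.stirlingSecond n m := by
  induction n generalizing m with
  | zero =>
    cases m with
    | zero => simp [S]
    | succ m => simp [S_zero_succ]
  | succ n ih =>
    cases m with
    | zero => simp [S]
    | succ m =>
      rw [S_rec, ih, ih, Nat.stirlingSecond_succ_succ]
      push_cast
      ring

lemma S_alt (c K : ℕ) : ∑ r ∈ Finset.range K, (-1 : ℚ)^r * r.factorial * S (c+2) (r+1)
    = - ((-1 : ℚ)^K * K.factorial * S (c+1) K) := by
  induction K with
  | zero => simp [S_eq]
  | succ K ih =>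
    rw [Finset.sum_range_succ, ih, S_rec, Nat.factorial_succ]
    push_cast
    ring

lemma choose_alt (n : ℕ) :
    ∑ r ∈ Finset.range (n+1), (-1 : ℚ)^r * ((n+1).choose (r+1) : ℚ) = 1 := by
  have h := add_pow (-1 : ℚ) 1 (n+1)
  rw [Finset.sum_range_succ'] at h
  simp only [one_pow, mul_one, neg_add_cancel, pow_succ, mul_zero, Nat.choose_zero_right,
    Nat.cast_one, pow_zero, mul_neg, neg_mul, Finset.sum_neg_distrib] at h
  linarith

lemma det_M (n : ℕ) (A : Matrix (Fin (n+1)) (Fin (n+1)) ℚ)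
    (hA : ∀ r c, A r c = if c.val = 0 then (1 / ((r.val).factorial : ℚ)) * ((n+1).choose (r.val+1) : ℚ)
      else S (c.val+1) (r.val+1)) : A.det = 1 := by
  have h := Matrix.det_updateRow_sum A 0 (fun r => (-1 : ℚ)^r.val * r.val.factorial)
  simp only [Fin.val_zero, pow_zero, Nat.factorial_zero, Nat.cast_one, mul_one, one_smul] at h
  have hrow : (∑ r : Fin (n+1), ((-1 : ℚ)^r.val * r.val.factorial) • A r) = Pi.single 0 1 := by
    funext c
    rw [Finset.sum_apply]
    simp only [Pi.smul_apply, smul_eq_mul, hA]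
    refine Fin.cases ?_ (fun c => ?_) c
    · have hc := choose_alt n
      rw [Finset.sum_range] at hc
      rw [Pi.single_eq_same]
      refine Eq.trans ?_ hc
      apply Finset.sum_congr rfl
      intro r _
      have : (r.val.factorial : ℚ) ≠ 0 := by positivity
      simp only [Fin.val_zero, if_true]
      field_simp
    · rw [Pi.single_eq_of_ne (Fin.succ_ne_zero c)]
      have := S_alt c.val (n+1)
      rw [Finset.sum_range, S_eq (c.val+1), Nat.stirlingSecond_eq_zero_of_lt (by omega)] at this
      simpa using this
  rw [hrow] at h
  rw [← h, Matrix.det_succ_row_zero, Fin.sum_univ_succ, Finset.sum_eq_zero]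
  · simp only [Fin.val_zero, pow_zero, one_mul, Matrix.updateRow_self, Pi.single_eq_same, add_zero]
    rw [Matrix.det_of_upperTriangular]
    · apply Finset.prod_eq_one
      intro i _
      simp [Matrix.updateRow_ne, hA, S_eq, Nat.stirlingSecond_self]
    · intro i j hij
      have hij' : j.val < i.val := hij
      simp only [Matrix.submatrix_apply, Fin.succAbove_zero]
      rw [Matrix.updateRow_ne (Fin.succ_ne_zero i), hA, S_eq, Nat.stirlingSecond_eq_zero_of_lt]
      · simp
      · simpa using hij'
  · intro i _
    simp

theorem a_k_zero_eq_one (k : ℕ) (hk : 1 ≤ k) : a k 1 = 1 ∧ (M k 1).det = 1 := by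
  have h : (M k 1).det = 1 := by
    obtain ⟨n, rfl⟩ : ∃ n, k = n + 1 := ⟨k - 1, by omega⟩
    refine det_M n (M (n+1) 1) ?_
    intro r c
    have h1 : 1 + r.val - 1 = r.val := by omega
    unfold M
    rw [h1, add_comm 1 r.val, add_comm 1 c.val]
  refine ⟨?_, h⟩
  unfold a
  rw [h]
  norm_num
end
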